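/- For all integers m ≥ n ≥ 1, the price of envy-freeness satisfies the lower bound p_envy(n,m) ≥ (1/2)·√n − 1/2. -/

import Mathlib

open Finset

/-- A utility matrix for `n` agents and `m` items: `x i j` is the (nonnegative)
utility of agent `j` for item `i`, and each agent's utilities sum to `1`. -/
def IsUtilMatrix (n m : ℕ) (x : Fin m → Fin n → ℝ) : Prop :=
  (∀ i j, 0 ≤ x i j) ∧ (∀ j, ∑ i, x i j = 1)

/-- The utility that agent `j` assigns to the bundle of items allocated to
agent `j'` by the allocation `A`. -/
def bundleUtil {n m : ℕ} (x : Fin m → Fin n → ℝ) (A : Fin m → Fin n)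
    (j j' : Fin n) : ℝ :=
  ∑ i ∈ Finset.univ.filter (fun i => A i = j'), x i j

/-- The allocation `A` is envy-free: no agent values another agent's bundle
more than its own. -/
def EnvyFree {n m : ℕ} (x : Fin m → Fin n → ℝ) (A : Fin m → Fin n) : Prop :=
  ∀ j j', bundleUtil x A j j ≥ bundleUtil x A j j'

/-- The welfare of allocation `A`: the sum of the agents' utilities for
their own bundles. -/
def welfare {n m : ℕ} (x : Fin m → Fin n → ℝ) (A : Fin m → Fin n) : ℝ :=
  ∑ j, bundleUtil x A j j

/-- Optimal welfare over all allocations. -/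
noncomputable def uStar (n m : ℕ) (x : Fin m → Fin n → ℝ) : ℝ :=
  sSup {w : ℝ | ∃ A : Fin m → Fin n, w = welfare x A}

/-- Optimal welfare over all envy-free allocations. -/
noncomputable def uStarF (n m : ℕ) (x : Fin m → Fin n → ℝ) : ℝ :=
  sSup {w : ℝ | ∃ A : Fin m → Fin n, EnvyFree x A ∧ w = welfare x A}

/-- The price of envy-freeness for `n` agents and `m` items: the supremum of
`uStar x / uStarF x` over all utility matrices admitting an envy-free
allocation. -/
noncomputable def pEnvy (n m : ℕ) : ℝ :=
  sSup {r : ℝ | ∃ x : Fin m → Fin n → ℝ, IsUtilMatrix n m x ∧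
    (∃ A : Fin m → Fin n, EnvyFree x A) ∧ r = uStar n m x / uStarF n m x}

theorem sum_bundleUtil {n m : ℕ} {x : Fin m → Fin n → ℝ} (hx : IsUtilMatrix n m x)
    (A : Fin m → Fin n) (j : Fin n) : ∑ j', bundleUtil x A j j' = 1 := by
  unfold bundleUtil
  rw [Finset.sum_fiberwise, hx.2 j]

theorem bundleUtil_nonneg {n m : ℕ} {x : Fin m → Fin n → ℝ} (hx : IsUtilMatrix n m x)
    (A : Fin m → Fin n) (j j' : Fin n) : 0 ≤ bundleUtil x A j j' :=
  Finset.sum_nonneg fun i _ => hx.1 i j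

theorem bundleUtil_le_one {n m : ℕ} {x : Fin m → Fin n → ℝ} (hx : IsUtilMatrix n m x)
    (A : Fin m → Fin n) (j j' : Fin n) : bundleUtil x A j j' ≤ 1 := by
  rw [← sum_bundleUtil hx A j]
  exact Finset.single_le_sum (fun k _ => bundleUtil_nonneg hx A j k) (Finset.mem_univ j')

theorem welfare_le {n m : ℕ} {x : Fin m → Fin n → ℝ} (hx : IsUtilMatrix n m x)
    (A : Fin m → Fin n) : welfare x A ≤ n := by
  calc welfare x A ≤ ∑ _j : Fin n, (1 : ℝ) :=
        Finset.sum_le_sum fun j _ => bundleUtil_le_one hx A j j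
    _ = n := by simp

theorem one_le_mul_bundleUtil {n m : ℕ} {x : Fin m → Fin n → ℝ} (hx : IsUtilMatrix n m x)
    {A : Fin m → Fin n} (hA : EnvyFree x A) (j : Fin n) : 1 ≤ n * bundleUtil x A j j := by
  calc (1 : ℝ) = ∑ j', bundleUtil x A j j' := (sum_bundleUtil hx A j).symm
    _ ≤ ∑ _j' : Fin n, bundleUtil x A j j := Finset.sum_le_sum fun j' _ => hA j j'
    _ = n * bundleUtil x A j j := by simp

theorem EnvyFree.one_le_welfare {n m : ℕ} (hn : 1 ≤ n) {x : Fin m → Fin n → ℝ}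
    (hx : IsUtilMatrix n m x) {A : Fin m → Fin n} (hA : EnvyFree x A) : 1 ≤ welfare x A := by
  have hn' : (0 : ℝ) < n := by exact_mod_cast hn
  have h : ∑ _j : Fin n, (1 : ℝ) ≤ ∑ j, n * bundleUtil x A j j :=
    Finset.sum_le_sum fun j _ => one_le_mul_bundleUtil hx hA j
  rw [← Finset.mul_sum] at h
  simp only [Finset.sum_const, Finset.card_univ, Fintype.card_fin, nsmul_eq_mul] at h
  exact le_of_mul_le_mul_left h hn'

theorem welfare_le_uStar {n m : ℕ} {x : Fin m → Fin n → ℝ} (hx : IsUtilMatrix n m x)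
    (A : Fin m → Fin n) : welfare x A ≤ uStar n m x :=
  le_csSup ⟨n, by rintro _ ⟨B, rfl⟩; exact welfare_le hx B⟩ ⟨A, rfl⟩

theorem uStar_le {n m : ℕ} {x : Fin m → Fin n → ℝ} (hx : IsUtilMatrix n m x) :
    uStar n m x ≤ n :=
  Real.sSup_le (by rintro _ ⟨B, rfl⟩; exact welfare_le hx B) n.cast_nonneg

theorem one_le_uStarF {n m : ℕ} (hn : 1 ≤ n) {x : Fin m → Fin n → ℝ}
    (hx : IsUtilMatrix n m x) (hA : ∃ A : Fin m → Fin n, EnvyFree x A) :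
    1 ≤ uStarF n m x := by
  obtain ⟨A, hA⟩ := hA
  exact (hA.one_le_welfare hn hx).trans
    (le_csSup ⟨n, by rintro _ ⟨B, -, rfl⟩; exact welfare_le hx B⟩ ⟨A, hA, rfl⟩)

theorem uStar_div_uStarF_le_pEnvy {n m : ℕ} (hn : 1 ≤ n) {x : Fin m → Fin n → ℝ}
    (hx : IsUtilMatrix n m x) (hA : ∃ A : Fin m → Fin n, EnvyFree x A) :
    uStar n m x / uStarF n m x ≤ pEnvy n m := by
  refine le_csSup ⟨n, ?_⟩ ⟨x, hx, hA, rfl⟩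
  rintro _ ⟨y, hy, hB, rfl⟩
  have h1 := one_le_uStarF hn hy hB
  refine div_le_of_le_mul₀ (by linarith) n.cast_nonneg ((uStar_le hy).trans ?_)
  exact le_mul_of_one_le_right n.cast_nonneg h1

/-- If only the first `n` items have value, every envy-free allocation to `n` agents gives each
agent exactly one of these items. -/
theorem EnvyFree.exists_bundleUtil_eq {n m : ℕ} (hm : n ≤ m)
    {x : Fin m → Fin n → ℝ} (hx : IsUtilMatrix n m x)
    (hzero : ∀ (i : Fin m) (j : Fin n), n ≤ (i : ℕ) → x i j = 0)
    {A : Fin m → Fin n} (hA : EnvyFree x A) (j : Fin n) :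
    ∃ i, bundleUtil x A j j = x i j := by
  let B : Fin n → Fin n := fun k => A (Fin.castLE hm k)
  have hsurj : Function.Surjective B := by
    intro k
    by_contra! h
    have h0 : bundleUtil x A k k = 0 := by
      refine Finset.sum_eq_zero fun i hi => hzero i k ?_
      by_contra! hlt
      exact h ⟨i, hlt⟩ (Finset.mem_filter.mp hi).2
    have h1 := one_le_mul_bundleUtil hx hA k
    rw [h0] at h1
    norm_num at h1
  have hinj : Function.Injective B := Finite.injective_iff_surjective.mpr hsurj
  obtain ⟨k, hk⟩ := hsurj j
  refine ⟨Fin.castLE hm k, Finset.sum_eq_single _ (fun i hi hne => hzero i j ?_) (fun h => ?_)⟩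
  · by_contra! hlt
    have : (⟨i, hlt⟩ : Fin n) = k := hinj (((Finset.mem_filter.mp hi).2).trans hk.symm)
    exact hne (by rw [← this]; rfl)
  · exact absurd (Finset.mem_filter.mpr ⟨Finset.mem_univ (Fin.castLE hm k), hk⟩) h

/-- Agents `j < s` are specialists with pairwise disjoint sets of `s` equally valued items; the
remaining agents value the first `n` items equally. -/
noncomputable def specialistUtil (n m s : ℕ) (i : Fin m) (j : Fin n) : ℝ :=
  if (j : ℕ) < s then (if (i : ℕ) < s * s ∧ (i : ℕ) % s = j then 1 / s else 0)
  else if (i : ℕ) < n then 1 / n else 0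

theorem sum_range_mul_ite_mod_eq (s k j : ℕ) (hj : j < s) (c : ℝ) :
    ∑ i ∈ Finset.range (s * k), (if i % s = j then c else 0) = k * c := by
  induction k with
  | zero => simp
  | succ k ih =>
    have h : ∑ i ∈ Finset.range s, (if (s * k + i) % s = j then c else 0) = c := by
      rw [Finset.sum_eq_single j]
      · simp [Nat.mod_eq_of_lt hj]
      · intro i hi hne
        rw [if_neg]
        rwa [Nat.mul_add_mod, Nat.mod_eq_of_lt (Finset.mem_range.mp hi)]
      · intro h
        exact absurd (Finset.mem_range.mpr hj) h
    rw [Nat.mul_succ, Finset.sum_range_add, ih, h]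
    push_cast
    ring

theorem sum_fin_ite_lt {k m : ℕ} (hk : k ≤ m) (f : ℕ → ℝ) :
    ∑ i : Fin m, (if (i : ℕ) < k then f i else 0) = ∑ i ∈ Finset.range k, f i := by
  rw [Fin.sum_univ_eq_sum_range (fun i => if i < k then f i else 0), ← Finset.sum_filter]
  congr 1
  ext i
  simp only [Finset.mem_filter, Finset.mem_range]
  omega

theorem isUtilMatrix_specialistUtil {n m s : ℕ} (hn : 1 ≤ n) (hm : n ≤ m) (hs : 1 ≤ s)
    (hsn : s * s ≤ n) : IsUtilMatrix n m (specialistUtil n m s) := by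
  have hs' : (s : ℝ) ≠ 0 := by positivity
  have hn' : (n : ℝ) ≠ 0 := by positivity
  refine ⟨fun i j => ?_, fun j => ?_⟩
  · unfold specialistUtil
    split_ifs <;> positivity
  · unfold specialistUtil
    by_cases hj : (j : ℕ) < s
    · simp only [if_pos hj, ite_and]
      rw [sum_fin_ite_lt (hsn.trans hm) (fun i => if i % s = j then 1 / (s : ℝ) else 0),
        sum_range_mul_ite_mod_eq s s j hj]
      field_simp
    · simp only [if_neg hj]
      rw [sum_fin_ite_lt hm (fun _ => 1 / (n : ℝ))]
      simp [hn']

theorem specialistUtil_eq_zero {n m s : ℕ} (hsn : s * s ≤ n) (i : Fin m) (j : Fin n)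
    (hi : n ≤ (i : ℕ)) : specialistUtil n m s i j = 0 := by
  unfold specialistUtil
  rw [if_neg (by omega : ¬ ((i : ℕ) < s * s ∧ (i : ℕ) % s = j)),
    if_neg (by omega : ¬ (i : ℕ) < n), ite_self]

theorem specialistUtil_le {n m s : ℕ} (i : Fin m) (j : Fin n) :
    specialistUtil n m s i j ≤ if (j : ℕ) < s then 1 / (s : ℝ) else 1 / n := by
  unfold specialistUtil
  split_ifs <;> first | exact le_rfl | positivity

theorem specialistUtil_self {n m s : ℕ} (hm : n ≤ m) (j : Fin n) :
    specialistUtil n m s (Fin.castLE hm j) j = if (j : ℕ) < s then 1 / (s : ℝ) else 1 / n := by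
  unfold specialistUtil
  split_ifs with h1 h2 h3
  · rfl
  · exact absurd ⟨by simpa using h1.trans_le (Nat.le_mul_self s), Nat.mod_eq_of_lt h1⟩ h2
  · rfl
  · exact absurd j.isLt h3

theorem exists_envyFree_specialistUtil {n m s : ℕ} (hn : 1 ≤ n) (hm : n ≤ m)
    (hsn : s * s ≤ n) : ∃ A : Fin m → Fin n, EnvyFree (specialistUtil n m s) A := by
  let A : Fin m → Fin n := fun i => if h : (i : ℕ) < n then ⟨i, h⟩ else ⟨0, hn⟩
  have hb : ∀ j j', bundleUtil (specialistUtil n m s) A j j'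
      = specialistUtil n m s (Fin.castLE hm j') j := by
    intro j j'
    refine Finset.sum_eq_single _ (fun i hi hne => specialistUtil_eq_zero hsn i j ?_)
      (fun h => ?_)
    · by_contra! hlt
      have hi := (Finset.mem_filter.mp hi).2
      simp only [A, dif_pos hlt] at hi
      exact hne (by rw [← hi]; rfl)
    · exact absurd (Finset.mem_filter.mpr ⟨Finset.mem_univ _, by simp [A]⟩) h
  refine ⟨A, fun j j' => ?_⟩
  rw [hb, hb, specialistUtil_self]
  exact specialistUtil_le _ _

theorem uStarF_specialistUtil_le {n m s : ℕ} (hn : 1 ≤ n) (hm : n ≤ m) (hs : 1 ≤ s)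
    (hsn : s * s ≤ n) : uStarF n m (specialistUtil n m s) ≤ 2 := by
  have hs' : (s : ℝ) ≠ 0 := by positivity
  have hn' : (n : ℝ) ≠ 0 := by positivity
  have hx := isUtilMatrix_specialistUtil hn hm hs hsn
  refine Real.sSup_le ?_ zero_le_two
  rintro _ ⟨A, hA, rfl⟩
  calc welfare (specialistUtil n m s) A
      ≤ ∑ j : Fin n, ((if (j : ℕ) < s then 1 / (s : ℝ) else 0) + 1 / n) := by
        refine Finset.sum_le_sum fun j _ => ?_
        obtain ⟨i, hi⟩ := hA.exists_bundleUtil_eq hm hx (specialistUtil_eq_zero hsn) j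
        rw [hi]
        refine (specialistUtil_le i j).trans ?_
        split_ifs
        · exact le_add_of_nonneg_right (by positivity)
        · simp
    _ = 2 := by
        rw [Finset.sum_add_distrib,
          sum_fin_ite_lt ((Nat.le_mul_self s).trans hsn) (fun _ => 1 / (s : ℝ))]
        simp [hs', hn']
        norm_num

theorem le_uStar_specialistUtil {n m s : ℕ} (hn : 1 ≤ n) (hm : n ≤ m) (hs : 1 ≤ s)
    (hsn : s * s ≤ n) : (s : ℝ) ≤ uStar n m (specialistUtil n m s) := by
  have hx := isUtilMatrix_specialistUtil hn hm hs hsn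
  have hsn' : s ≤ n := (Nat.le_mul_self s).trans hsn
  let A : Fin m → Fin n := fun i => ⟨(i : ℕ) % s, (Nat.mod_lt _ hs).trans_le hsn'⟩
  refine le_trans ?_ (welfare_le_uStar hx A)
  calc (s : ℝ) = ∑ j : Fin n, (if (j : ℕ) < s then (1 : ℝ) else 0) := by
        rw [sum_fin_ite_lt hsn' (fun _ => (1 : ℝ))]
        simp
    _ ≤ welfare (specialistUtil n m s) A := by
        refine Finset.sum_le_sum fun j _ => ?_
        split_ifs with hj
        · rw [← hx.2 j]
          refine (Finset.sum_subset (Finset.filter_subset _ _) fun i _ hi => ?_).ge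
          have hne : (i : ℕ) % s ≠ j := fun h =>
            hi (Finset.mem_filter.mpr ⟨Finset.mem_univ _, Fin.ext h⟩)
          simp [specialistUtil, hj, hne]
        · exact bundleUtil_nonneg hx A j j

/-- For all integers `m ≥ n ≥ 1`, the price of envy-freeness satisfies the
lower bound `p_envy(n,m) ≥ (1/2)·√n − 1/2`. -/
theorem pEnvy_lower_bound (n m : ℕ) (hn : 1 ≤ n) (hm : n ≤ m) :
    pEnvy n m ≥ (1 / 2) * Real.sqrt n - 1 / 2 := by
  have hs : 1 ≤ Nat.sqrt n := Nat.sqrt_pos.mpr hn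
  have hsn : Nat.sqrt n * Nat.sqrt n ≤ n := Nat.sqrt_le n
  have hx := isUtilMatrix_specialistUtil hn hm hs hsn
  have hA := exists_envyFree_specialistUtil hn hm hsn
  have hF := one_le_uStarF hn hx hA
  have hU := le_uStar_specialistUtil hn hm hs hsn
  have hratio : (Nat.sqrt n : ℝ) / 2 ≤ pEnvy n m :=
    (div_le_div₀ ((Nat.cast_nonneg _).trans hU) hU (by linarith)
      (uStarF_specialistUtil_le hn hm hs hsn)).trans (uStar_div_uStarF_le_pEnvy hn hx hA)
  have hsqrt : Real.sqrt n ≤ Nat.sqrt n + 1 := Real.real_sqrt_le_nat_sqrt_succ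
  linarith
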